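/- For every ξ′ = (ξ₁,ξ₂) ∈ ℝ² and μ ∈ ℝ, the four vectors h₁,₊(ξ′,μ), h₂,₊(ξ′,μ), h₁,₋(ξ′,μ), h₂,₋(ξ′,μ) are pairwise orthogonal in ℂ⁴ with respect to the inner product ⟨u,v⟩ = Σᵢ uᵢ·conj(vᵢ). -/

import Mathlib

open Matrix Complex

noncomputable section

/-- Pauli matrices -/
def σ1 : Matrix (Fin 2) (Fin 2) ℂ := !![0, 1; 1, 0]
def σ2 : Matrix (Fin 2) (Fin 2) ℂ := !![0, -I; I, 0]
def σ3 : Matrix (Fin 2) (Fin 2) ℂ := !![1, 0; 0, -1]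

/-- `ρ = √(|ξ′|² + μ²)`. -/
def ρ (ξ₁ ξ₂ μ : ℝ) : ℝ := Real.sqrt (ξ₁ ^ 2 + ξ₂ ^ 2 + μ ^ 2)

/-- `Λ±(ξ′,μ) = ξ₁σ₁ + ξ₂σ₂ ± iρσ₃`. -/
def Λp (ξ₁ ξ₂ μ : ℝ) : Matrix (Fin 2) (Fin 2) ℂ :=
  (ξ₁ : ℂ) • σ1 + (ξ₂ : ℂ) • σ2 + (I * (ρ ξ₁ ξ₂ μ : ℝ)) • σ3
def Λm (ξ₁ ξ₂ μ : ℝ) : Matrix (Fin 2) (Fin 2) ℂ :=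
  (ξ₁ : ℂ) • σ1 + (ξ₂ : ℂ) • σ2 - (I * (ρ ξ₁ ξ₂ μ : ℝ)) • σ3

/-- `e₁ = (1,0)`, `e₂ = (0,1) ∈ ℂ²`. -/
def e1 : Fin 2 → ℂ := ![1, 0]
def e2 : Fin 2 → ℂ := ![0, 1]

/-- `h₁,± = (iμ·e₁, Λ±e₁)` and `h₂,± = (Λ±e₂, iμ·e₂)` in `ℂ⁴`. -/
def h1p (ξ₁ ξ₂ μ : ℝ) : (Fin 2 ⊕ Fin 2) → ℂ :=
  Sum.elim ((I * μ) • e1) ((Λp ξ₁ ξ₂ μ).mulVec e1)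
def h2p (ξ₁ ξ₂ μ : ℝ) : (Fin 2 ⊕ Fin 2) → ℂ :=
  Sum.elim ((Λp ξ₁ ξ₂ μ).mulVec e2) ((I * μ) • e2)
def h1m (ξ₁ ξ₂ μ : ℝ) : (Fin 2 ⊕ Fin 2) → ℂ :=
  Sum.elim ((I * μ) • e1) ((Λm ξ₁ ξ₂ μ).mulVec e1)
def h2m (ξ₁ ξ₂ μ : ℝ) : (Fin 2 ⊕ Fin 2) → ℂ :=
  Sum.elim ((Λm ξ₁ ξ₂ μ).mulVec e2) ((I * μ) • e2)

/-- the vectors `h₁,₊, h₂,₊, h₁,₋, h₂,₋` are pairwise orthogonal in `ℂ⁴`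
w.r.t. `⟨u,v⟩ = Σᵢ uᵢ · conj(vᵢ)`. -/
theorem h_param_pairwise_orthogonal (ξ₁ ξ₂ μ : ℝ) :
    ∀ i j : Fin 4, i ≠ j →
      ∑ k, (![h1p ξ₁ ξ₂ μ, h2p ξ₁ ξ₂ μ, h1m ξ₁ ξ₂ μ, h2m ξ₁ ξ₂ μ] i k) *
        (starRingEnd ℂ) (![h1p ξ₁ ξ₂ μ, h2p ξ₁ ξ₂ μ, h1m ξ₁ ξ₂ μ, h2m ξ₁ ξ₂ μ] j k) = 0 := by
  have hρ : ((ρ ξ₁ ξ₂ μ : ℝ) : ℂ) ^ 2 = (ξ₁ : ℂ) ^ 2 + (ξ₂ : ℂ) ^ 2 + (μ : ℂ) ^ 2 := by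
    have h : (ρ ξ₁ ξ₂ μ) ^ 2 = ξ₁ ^ 2 + ξ₂ ^ 2 + μ ^ 2 := by
      unfold ρ
      exact Real.sq_sqrt (by positivity)
    exact_mod_cast h
  have hI : I ^ 2 = -1 := I_sq
  intro i j hij
  fin_cases i <;> fin_cases j <;>
    first
    | exact absurd rfl hij
    | (simp [h1p, h2p, h1m, h2m, Λp, Λm, σ1, σ2, σ3, e1, e2, Matrix.mulVec, dotProduct,
        Fin.sum_univ_two, Fintype.sum_sum_type]
       try ring_nf
       try simp only [hI, hρ]
       try ring)
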